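/- arXiv:0802.1853 — 2 statements merged into one kernel-verified Lean document; each statement's English description precedes it below -/
import Mathlib

section
/- The number of maximal invariant linked systems on the quaternion group Q₈ of order 8 is exactly 8. -/
open Pointwise

/-- A family `L` of subsets of `X` is *linked* if any two of its members intersect
(in particular every member is nonempty). -/
def Linked {X : Type*} (L : Set (Set X)) : Prop :=
  ∀ A ∈ L, ∀ B ∈ L, (A ∩ B).Nonempty

/-- A family `L` of subsets of a group `X` is *invariant* if `xA ∈ L` for all `A ∈ L`
and all `x ∈ X`. -/
def Invariant {X : Type*} [Group X] (L : Set (Set X)) : Prop :=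
  ∀ x : X, ∀ A ∈ L, x • A ∈ L

/-- A *maximal invariant linked system* on a group `X` is an invariant linked family of
subsets of `X` not properly contained in any other invariant linked family. -/
def IsMaxInvLinked {X : Type*} [Group X] (L : Set (Set X)) : Prop :=
  Linked L ∧ Invariant L ∧
    ∀ M : Set (Set X), Linked M → Invariant M → L ⊆ M → M = L

/-- A *maximal linked system* on `X` is a linked family of subsets of `X` not properly
contained in any other linked family. -/
def IsMaxLinked {X : Type*} (L : Set (Set X)) : Prop :=
  Linked L ∧ ∀ M : Set (Set X), Linked M → L ⊆ M → M = L

/-- The operation `A∘B = {C ⊆ X : {x ∈ X : x⁻¹C ∈ B} ∈ A}`, where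
`x⁻¹C = {y ∈ X : xy ∈ C}`. -/
def circ {X : Type*} [Group X] (A B : Set (Set X)) : Set (Set X) :=
  {C : Set X | {x : X | (x * ·) ⁻¹' C ∈ B} ∈ A}

open QuaternionGroup in
/-- Four-element subsets of `Q₈`. Together with their complements, they represent the orbits of
those four-element subsets that are not translates of their own complement. -/
def quaternionQuad : Fin 3 → Finset (QuaternionGroup 2) :=
  ![{a 0, a 1, a 2, xa 0}, {a 0, a 1, a 2, xa 1}, {a 0, a 1, xa 0, xa 2}]

/-- The set `quaternionQuad i` or its complement, according to the given Boolean. -/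
def signedQuad (b : Bool) (i : Fin 3) : Finset (QuaternionGroup 2) :=
  if b then quaternionQuad i else (quaternionQuad i)ᶜ

theorem card_signedQuad : ∀ b i, (signedQuad b i).card = 4 := by
  decide +kernel

theorem signedQuad_inter_smul_nonempty : ∀ i j b c, (i = j → b = c) →
    ∀ x : QuaternionGroup 2, (signedQuad b i ∩ x • signedQuad c j).Nonempty := by
  decide +kernel

theorem large_or_disjoint_smul_or_eq_smul_signedQuad : ∀ A : Finset (QuaternionGroup 2),
    5 ≤ A.card ∨ (∃ x : QuaternionGroup 2, A ∩ x • A = ∅) ∨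
      ∃ (x : QuaternionGroup 2) (i : Fin 3) (b : Bool), A = x • signedQuad b i := by
  decide +kernel

/-- The invariant family of subsets of `Q₈` generated by the sets with at least five elements
and, for each `i`, the translates of `signedQuad (f i) i`. -/
def quaternionSystem (f : Fin 3 → Bool) : Set (Set (QuaternionGroup 2)) :=
  {A | 5 ≤ A.ncard ∨ ∃ (x : QuaternionGroup 2) (i : Fin 3), A = x • (signedQuad (f i) i : Set _)}

theorem signedQuad_mem_quaternionSystem (f : Fin 3 → Bool) (i : Fin 3) :
    (signedQuad (f i) i : Set (QuaternionGroup 2)) ∈ quaternionSystem f :=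
  Or.inr ⟨1, i, (one_smul _ _).symm⟩

theorem inter_nonempty_of_card_lt {X : Type*} [Finite X] {A B : Set X}
    (h : Nat.card X < A.ncard + B.ncard) : (A ∩ B).Nonempty := by
  by_contra hAB
  have hd : Disjoint A B := Set.disjoint_iff_inter_eq_empty.2 (Set.not_nonempty_iff_eq_empty.1 hAB)
  have hu := Set.ncard_union_eq hd
  have hc := Set.ncard_le_card (A ∪ B)
  omega

theorem natCard_quaternionGroup_two : Nat.card (QuaternionGroup 2) = 8 := by
  rw [Nat.card_eq_fintype_card, QuaternionGroup.card]

theorem four_le_ncard_of_mem_quaternionSystem {f : Fin 3 → Bool} {A : Set (QuaternionGroup 2)}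
    (hA : A ∈ quaternionSystem f) : 4 ≤ A.ncard := by
  obtain hA | ⟨x, i, rfl⟩ := hA
  · omega
  · rw [← Finset.coe_smul_finset, Set.ncard_coe_finset, Finset.card_smul_finset, card_signedQuad]

theorem linked_quaternionSystem (f : Fin 3 → Bool) : Linked (quaternionSystem f) := by
  intro A hA B hB
  have hA' := four_le_ncard_of_mem_quaternionSystem hA
  have hB' := four_le_ncard_of_mem_quaternionSystem hB
  have hX := natCard_quaternionGroup_two
  obtain hA | ⟨x, i, rfl⟩ := hA
  · exact inter_nonempty_of_card_lt (by omega)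
  obtain hB | ⟨y, j, rfl⟩ := hB
  · exact inter_nonempty_of_card_lt (by omega)
  have h := signedQuad_inter_smul_nonempty i j (f i) (f j) (congrArg f) (x⁻¹ * y)
  rw [← Finset.coe_nonempty, Finset.coe_inter, Finset.coe_smul_finset] at h
  rw [← Set.smul_set_nonempty (a := x⁻¹), Set.smul_set_inter, inv_smul_smul, smul_smul]
  exact h

theorem invariant_quaternionSystem (f : Fin 3 → Bool) : Invariant (quaternionSystem f) := by
  rintro x A (hA | ⟨y, i, rfl⟩)
  · left
    rwa [Set.ncard_smul_set]
  · exact Or.inr ⟨x * y, i, (mul_smul _ _ _).symm⟩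

theorem exists_subset_quaternionSystem {M : Set (Set (QuaternionGroup 2))}
    (hM : Linked M) (hinv : Invariant M) : ∃ f, M ⊆ quaternionSystem f := by
  classical
  refine ⟨fun i => decide ((quaternionQuad i : Set (QuaternionGroup 2)) ∈ M), fun A hA => ?_⟩
  lift A to Finset (QuaternionGroup 2) using A.toFinite
  obtain h | ⟨x, hx⟩ | ⟨x, i, b, rfl⟩ := large_or_disjoint_smul_or_eq_smul_signedQuad A
  · left
    rwa [Set.ncard_coe_finset]
  · have h := hM _ hA _ (hinv x _ hA)
    rw [← Finset.coe_smul_finset, ← Finset.coe_inter, hx] at h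
    simp at h
  · have hb : (signedQuad b i : Set (QuaternionGroup 2)) ∈ M := by
      simpa using hinv x⁻¹ _ hA
    refine Or.inr ⟨x, i, ?_⟩
    rw [Finset.coe_smul_finset]
    congr 3
    cases b with
    | true => simpa [signedQuad] using hb
    | false =>
      rw [eq_comm, decide_eq_false_iff_not]
      intro h
      simpa [signedQuad] using hM _ h _ hb

theorem eq_of_quaternionSystem_subset {f g : Fin 3 → Bool}
    (h : quaternionSystem f ⊆ quaternionSystem g) : f = g := by
  funext i
  have hi := linked_quaternionSystem g _ (h (signedQuad_mem_quaternionSystem f i)) _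
    (signedQuad_mem_quaternionSystem g i)
  cases hf : f i <;> cases hg : g i <;> simp [hf, hg, signedQuad] at hi ⊢

theorem isMaxInvLinked_quaternionSystem (f : Fin 3 → Bool) :
    IsMaxInvLinked (quaternionSystem f) := by
  refine ⟨linked_quaternionSystem f, invariant_quaternionSystem f, fun M hM hinv hfM => ?_⟩
  obtain ⟨g, hg⟩ := exists_subset_quaternionSystem hM hinv
  obtain rfl := eq_of_quaternionSystem_subset (hfM.trans hg)
  exact hg.antisymm hfM

/-- The number of maximal invariant linked systems on the quaternion group `Q₈` of order 8
is exactly 8. -/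
theorem stmt12 :
    Nat.card {L : Set (Set (QuaternionGroup 2)) // IsMaxInvLinked L} = 8 := by
  have hbij : Function.Bijective fun f : Fin 3 → Bool =>
      (⟨quaternionSystem f, isMaxInvLinked_quaternionSystem f⟩ :
        {L : Set (Set (QuaternionGroup 2)) // IsMaxInvLinked L}) := by
    refine ⟨fun f g h => eq_of_quaternionSystem_subset (congrArg Subtype.val h).subset, ?_⟩
    rintro ⟨L, hL, hinv, hmax⟩
    obtain ⟨f, hf⟩ := exists_subset_quaternionSystem hL hinv
    exact ⟨f, Subtype.ext
      (hmax _ (linked_quaternionSystem f) (invariant_quaternionSystem f) hf)⟩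
  rw [← Nat.card_eq_of_bijective _ hbij]
  simp
end

section
/- Let X be a group and L a maximal linked system on X. Then L is a right zero of the superextension λ(X), i.e. A∘L = L for every maximal linked system A on X, if and only if L is invariant. -/
open Pointwise

theorem Linked.nonempty {X : Type*} {L : Set (Set X)} (hL : Linked L) {A : Set X}
    (hA : A ∈ L) : A.Nonempty := by
  simpa using hL A hA A hA

/-- A nonempty set meeting every member of a maximal linked system belongs to it. -/
theorem IsMaxLinked.mem_of_forall_inter {X : Type*} {L : Set (Set X)} (hL : IsMaxLinked L)
    {C : Set X} (hC : C.Nonempty) (h : ∀ A ∈ L, (C ∩ A).Nonempty) : C ∈ L := by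
  have hlink : Linked (insert C L) := by
    rintro A (rfl | hA) B (rfl | hB)
    · simpa using hC
    · exact h B hB
    · rw [Set.inter_comm]
      exact h A hA
    · exact hL.1 A hA B hB
  rw [← hL.2 _ hlink (Set.subset_insert C L)]
  exact Set.mem_insert C L

theorem IsMaxLinked.univ_mem {X : Type*} [Nonempty X] {L : Set (Set X)}
    (hL : IsMaxLinked L) : Set.univ ∈ L :=
  hL.mem_of_forall_inter Set.univ_nonempty fun A hA => by
    simpa using hL.1.nonempty hA

theorem isMaxLinked_principal {X : Type*} (x : X) : IsMaxLinked {A : Set X | x ∈ A} := by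
  refine ⟨fun A hA B hB => ⟨x, hA, hB⟩, fun M hM hsub => ?_⟩
  refine Set.Subset.antisymm (fun A hA => ?_) hsub
  obtain ⟨y, hyA, rfl⟩ := hM A hA {x} (hsub (Set.mem_singleton x))
  exact hyA

theorem Invariant.preimage_mul_left_mem_iff {X : Type*} [Group X] {L : Set (Set X)}
    (hL : Invariant L) (x : X) (C : Set X) : (x * ·) ⁻¹' C ∈ L ↔ C ∈ L := by
  have hpre : (x * ·) ⁻¹' C = x⁻¹ • C := Set.preimage_smul x C
  rw [hpre]
  refine ⟨fun h => ?_, hL x⁻¹ C⟩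
  simpa using hL x _ h

/-- A maximal linked system `L` on a group `X` is a right zero of the superextension
`λ(X)` (i.e. `A∘L = L` for every maximal linked system `A`) if and only if `L` is
invariant. -/
theorem stmt14 {X : Type*} [Group X] (L : Set (Set X)) (hL : IsMaxLinked L) :
    (∀ A : Set (Set X), IsMaxLinked A → circ A L = L) ↔ Invariant L := by
  constructor
  · intro h x C hC
    have hmem : C ∈ circ {A : Set X | x⁻¹ ∈ A} L := by
      rwa [h _ (isMaxLinked_principal x⁻¹)]
    have hpre : (x⁻¹ * ·) ⁻¹' C ∈ L := hmem
    have heq : (x⁻¹ * ·) ⁻¹' C = x • C := by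
      simpa using Set.preimage_smul x⁻¹ C
    rwa [← heq]
  · intro hinv A hA
    ext C
    simp only [circ, Set.mem_ofPred_eq, hinv.preimage_mul_left_mem_iff]
    refine ⟨fun h => ?_, fun hC => ?_⟩
    · exact (hA.1.nonempty h).choose_spec
    · simpa [hC] using hA.univ_mem
end
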